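/- It is decidable whether a given k-automatic sequence is overlap-free. Precisely: there is an algorithm that, given an integer k ≥ 2 and a DFAO M generating a k-automatic sequence a = (a_n)_{n≥0}, decides whether a contains an overlap, equivalently whether there exist integers I ≥ 0 and T ≥ 1 such that a_{I+J} = a_{I+T+J} for all J with 0 ≤ J ≤ T. -/

import Mathlib

/-- Run an encoded DFAO transition table from state `q` on a list of base-`k`
digits, least significant digit first (this is `w^R` for a most-significant-first
representation `w`). -/
def dfaoRun (trans : List (List ℕ)) : ℕ → List ℕ → ℕ
  | q, [] => q
  | q, d :: ds => dfaoRun trans ((trans.getD q []).getD d 0) ds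

/-- The encoded DFAO `(trans, q0, out)` over input alphabet `Σ_k = {0,…,k-1}`
generates the sequence `a`: for every `m` and every base-`k` representation `w`
of `m` (given least significant digit first, possibly with trailing zeros,
all digits `< k`), the output on `w` is `a m`. -/
def dfaoGenerates (k : ℕ) (trans : List (List ℕ)) (q0 : ℕ) (out : List ℕ)
    (a : ℕ → ℕ) : Prop :=
  ∀ (m : ℕ) (w : List ℕ), (∀ d ∈ w, d < k) → Nat.ofDigits k w = m →
    a m = out.getD (dfaoRun trans q0 w) 0

/-- `a` contains an overlap, i.e., a factor of the form `axaxa` with `a` a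
letter and `x` a possibly empty word: equivalently, there exist `I ≥ 0` and
`T ≥ 1` with `a (I+J) = a (I+T+J)` for all `0 ≤ J ≤ T`. -/
def ContainsOverlap (a : ℕ → ℕ) : Prop :=
  ∃ I T : ℕ, 1 ≤ T ∧ ∀ J : ℕ, J ≤ T → a (I + J) = a (I + T + J)

/-- The base-`k` digits of `n` in the lowest `e` places, least significant digit first. -/
def lowDigits (k : ℕ) : ℕ → ℕ → List ℕ
  | 0, _ => []
  | e + 1, n => n % k :: lowDigits k e (n / k)

lemma lowDigits_lt {k : ℕ} (hk : 2 ≤ k) (e n : ℕ) : ∀ d ∈ lowDigits k e n, d < k := by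
  induction e generalizing n with
  | zero => simp [lowDigits]
  | succ e ih =>
    intro d hd
    rcases List.mem_cons.1 hd with rfl | hd
    · exact Nat.mod_lt _ (by omega)
    · exact ih _ _ hd

lemma length_lowDigits (k e n : ℕ) : (lowDigits k e n).length = e := by
  induction e generalizing n with
  | zero => rfl
  | succ e ih => simp [lowDigits, ih]

lemma ofDigits_lowDigits (k e n : ℕ) : Nat.ofDigits k (lowDigits k e n) = n % k ^ e := by
  induction e generalizing n with
  | zero => simp [lowDigits, Nat.mod_one]
  | succ e ih => simp [lowDigits, Nat.ofDigits_cons, ih, pow_succ', Nat.mod_mul]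

lemma dfaoRun_append (trans : List (List ℕ)) (q : ℕ) (u v : List ℕ) :
    dfaoRun trans q (u ++ v) = dfaoRun trans (dfaoRun trans q u) v := by
  induction u generalizing q with
  | nil => rfl
  | cons d u ih => exact ih _

lemma getD_le_encode {α : Type*} [Encodable α] (l : List α) (n : ℕ) (d : α) :
    Encodable.encode (l.getD n d) ≤ max (Encodable.encode l) (Encodable.encode d) := by
  induction l generalizing n with
  | nil => simp
  | cons x l ih =>
    have hx := Nat.left_le_pair (Encodable.encode x) (Encodable.encode l)
    have hl := Nat.right_le_pair (Encodable.encode x) (Encodable.encode l)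
    rw [Encodable.encode_list_cons]
    cases n with
    | zero =>
      rw [List.getD_cons_zero]
      omega
    | succ n =>
      rw [List.getD_cons_succ]
      have := ih n
      omega

lemma dfaoRun_le (trans : List (List ℕ)) (q : ℕ) (w : List ℕ) :
    dfaoRun trans q w ≤ max q (Encodable.encode trans) := by
  induction w generalizing q with
  | nil => exact le_max_left _ _
  | cons d w ih =>
    have h₁ := getD_le_encode trans q []
    have h₂ := getD_le_encode (trans.getD q []) d 0
    simp only [Encodable.encode_list_nil, Encodable.encode_nat] at h₁ h₂
    refine (ih _).trans ?_
    omega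

/-- The output of the encoded DFAO, started in state `q`, on a representation of `n`. -/
def dfaoOutput (k : ℕ) (trans : List (List ℕ)) (out : List ℕ) (q n : ℕ) : ℕ :=
  out.getD (dfaoRun trans q (lowDigits k n n)) 0

lemma dfaoGenerates.eq_output {k : ℕ} {trans : List (List ℕ)} {q0 : ℕ} {out : List ℕ}
    {a : ℕ → ℕ} (h : dfaoGenerates k trans q0 out a) (hk : 2 ≤ k) {e r : ℕ} (hr : r < k ^ e)
    (m : ℕ) :
    a (r + k ^ e * m) =
      dfaoOutput k trans out (dfaoRun trans q0 (lowDigits k e r)) m := by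
  rw [dfaoOutput, ← dfaoRun_append]
  apply h
  · intro d hd
    rcases List.mem_append.1 hd with hd | hd <;> exact lowDigits_lt hk _ _ _ hd
  · rw [Nat.ofDigits_append, ofDigits_lowDigits, ofDigits_lowDigits, length_lowDigits,
      Nat.mod_eq_of_lt hr, Nat.mod_eq_of_lt (Nat.lt_pow_self hk)]

/-- `a` has an overlap of period `T` starting at position `I`. -/
def OverlapAt (a : ℕ → ℕ) (I T : ℕ) : Prop :=
  1 ≤ T ∧ ∀ J, J ≤ T → a (I + J) = a (I + T + J)

/-- What the low-order parts `i` and `t` (modulo `k ^ e`) of a position and a period contribute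
to the overlap condition: for each low-order part `j` of an offset, the states reached on the low
digits of the two compared positions, the carries, and the comparison of `j` with `t`. -/
def overlapSummary (k : ℕ) (st : ℕ → ℕ → ℕ) (e i t : ℕ) :
    Bool × Finset (ℕ × ℕ × ℕ × ℕ × Bool) :=
  (decide (t = 0), (Finset.range (k ^ e)).image fun j =>
    (st e ((i + j) % k ^ e), (i + j) / k ^ e, st e ((i + t + j) % k ^ e),
      (i + t + j) / k ^ e, decide (j ≤ t)))

/-- The overlap condition on the high-order parts `I` and `T` of a position and a period, given
the summary of their low-order parts. -/
def SummaryOverlap (G : ℕ → ℕ → ℕ) (s : Bool × Finset (ℕ × ℕ × ℕ × ℕ × Bool)) (I T : ℕ) : Prop :=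
  (s.1 = true → 1 ≤ T) ∧ ∀ x ∈ s.2, ∀ J, (J < T ∨ J = T ∧ x.2.2.2.2 = true) →
    G x.1 (I + J + x.2.1) = G x.2.2.1 (I + T + J + x.2.2.2.1)

lemma overlapAt_iff_summaryOverlap {a : ℕ → ℕ} {k : ℕ} (hk : 2 ≤ k) {st G : ℕ → ℕ → ℕ}
    (hG : ∀ e r m, r < k ^ e → a (r + k ^ e * m) = G (st e r) m) {e i t I T : ℕ}
    (ht : t < k ^ e) :
    OverlapAt a (i + k ^ e * I) (t + k ^ e * T) ↔
      SummaryOverlap G (overlapSummary k st e i t) I T := by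
  have hK : 0 < k ^ e := by positivity
  have key : ∀ x m, a (x + k ^ e * m) = G (st e (x % k ^ e)) (m + x / k ^ e) := by
    intro x m
    rw [← hG _ _ _ (Nat.mod_lt _ hK)]
    congr 1
    conv_lhs => rw [← Nat.mod_add_div x (k ^ e)]
    ring
  have cmp : ∀ j J, j < k ^ e →
      (j + k ^ e * J ≤ t + k ^ e * T ↔ J < T ∨ J = T ∧ j ≤ t) := by
    intro j J hj
    rcases lt_trichotomy J T with h | rfl | h
    · have := Nat.mul_le_mul_left (k ^ e) (Nat.succ_le_of_lt h)
      rw [Nat.mul_succ] at this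
      simp only [h, true_or, iff_true]
      omega
    · simp
    · have := Nat.mul_le_mul_left (k ^ e) (Nat.succ_le_of_lt h)
      rw [Nat.mul_succ] at this
      constructor <;> intro <;> omega
  have key₁ : ∀ j J, a (i + k ^ e * I + (j + k ^ e * J)) =
      G (st e ((i + j) % k ^ e)) (I + J + (i + j) / k ^ e) := by
    intro j J
    rw [← key]
    congr 1
    ring
  have key₂ : ∀ j J, a (i + k ^ e * I + (t + k ^ e * T) + (j + k ^ e * J)) =
      G (st e ((i + t + j) % k ^ e)) (I + T + J + (i + t + j) / k ^ e) := by
    intro j J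
    rw [← key]
    congr 1
    ring
  unfold OverlapAt SummaryOverlap overlapSummary
  refine and_congr ?_ ?_
  · simp only [decide_eq_true_eq]
    rcases Nat.eq_zero_or_pos T with rfl | hT
    · simp; omega
    · have : 0 < k ^ e * T := by positivity
      constructor <;> intro <;> omega
  · simp only [Finset.forall_mem_image, Finset.mem_range, decide_eq_true_eq]
    constructor
    · intro h j hj J hJ
      rw [← key₁, ← key₂]
      exact h _ ((cmp j J hj).2 hJ)
    · intro h J hJ
      have hj := Nat.mod_lt J hK
      rw [← Nat.mod_add_div J (k ^ e)] at hJ ⊢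
      rw [key₁, key₂]
      exact h hj _ ((cmp _ _ hj).1 hJ)

/-- A bound on the number of summaries of a DFAO with at most `N` states. -/
def summaryBound (N : ℕ) : ℕ :=
  2 * 2 ^ (N * (3 * (N * (3 * 2))))

lemma exists_small_overlapAt {a : ℕ → ℕ} {k N : ℕ} (hk : 2 ≤ k) {st G : ℕ → ℕ → ℕ}
    (hN : ∀ e r, st e r < N)
    (hG : ∀ e r m, r < k ^ e → a (r + k ^ e * m) = G (st e r) m) {I T : ℕ}
    (h : OverlapAt a I T) :
    ∃ I' < k ^ summaryBound N, ∃ T' < k ^ summaryBound N, OverlapAt a I' T' := by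
  induction hn : I + T using Nat.strong_induction_on generalizing I T with
  | _ n ih =>
    subst hn
    by_cases hsmall : I < k ^ summaryBound N ∧ T < k ^ summaryBound N
    · exact ⟨I, hsmall.1, T, hsmall.2, h⟩
    let S := (Finset.univ : Finset Bool) ×ˢ (Finset.range N ×ˢ Finset.range 3 ×ˢ Finset.range N ×ˢ
      Finset.range 3 ×ˢ (Finset.univ : Finset Bool)).powerset
    have hS : S.card = summaryBound N := by
      simp [S, summaryBound]
    have hmaps : ∀ e ∈ Finset.range (summaryBound N + 1),
        overlapSummary k st e (I % k ^ e) (T % k ^ e) ∈ S := by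
      intro e _
      have hK : 0 < k ^ e := by positivity
      have hI := Nat.mod_lt I hK
      have hT := Nat.mod_lt T hK
      simp only [S, overlapSummary, Finset.mem_product, Finset.mem_univ, true_and,
        Finset.mem_powerset, Finset.image_subset_iff, Finset.mem_range, hN, and_true]
      intro j hj
      constructor <;> rw [Nat.div_lt_iff_lt_mul hK] <;> omega
    obtain ⟨e₁, he₁, e₂, he₂, hne, heq⟩ :=
      Finset.exists_ne_map_eq_of_card_lt_of_maps_to (by simp [hS]) hmaps
    wlog hlt : e₁ < e₂ generalizing e₁ e₂
    · exact this e₂ he₂ e₁ he₁ hne.symm heq.symm (by omega)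
    have hK₁ : 0 < k ^ e₁ := by positivity
    have hK₂ : 0 < k ^ e₂ := by positivity
    have hpow : k ^ e₁ < k ^ e₂ := Nat.pow_lt_pow_right (by omega) hlt
    have hle : k ^ e₁ ≤ k ^ summaryBound N :=
      Nat.pow_le_pow_right (by omega) (by simp at he₁; omega)
    have hdec : ∀ x, x % k ^ e₁ + k ^ e₁ * (x / k ^ e₂) ≤ x ∧
        (k ^ summaryBound N ≤ x → x % k ^ e₁ + k ^ e₁ * (x / k ^ e₂) < x) := by
      intro x
      have hx := Nat.mod_add_div x (k ^ e₁)
      constructor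
      · have := Nat.mul_le_mul_left (k ^ e₁) (Nat.div_le_div_left hpow.le hK₁ : x / k ^ e₂ ≤ _)
        omega
      · intro hxB
        have hq : x / k ^ e₂ < x / k ^ e₁ := by
          have hpos : 0 < x / k ^ e₁ := Nat.div_pos (hle.trans hxB) hK₁
          rw [Nat.div_lt_iff_lt_mul hK₂]
          have h₁ := Nat.lt_mul_div_succ x hK₁
          have h₂ : k ^ e₁ * (x / k ^ e₁ + 1) ≤ x / k ^ e₁ * k ^ e₂ := by
            have h₃ : 2 * k ^ e₁ ≤ k ^ e₂ :=
              calc 2 * k ^ e₁ ≤ k * k ^ e₁ := Nat.mul_le_mul_right _ hk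
                _ = k ^ (e₁ + 1) := (pow_succ' _ _).symm
                _ ≤ k ^ e₂ := Nat.pow_le_pow_right (by omega) hlt
            calc k ^ e₁ * (x / k ^ e₁ + 1) ≤ k ^ e₁ * (x / k ^ e₁ * 2) :=
                  Nat.mul_le_mul_left _ (by omega)
              _ = x / k ^ e₁ * (2 * k ^ e₁) := by ring
              _ ≤ _ := Nat.mul_le_mul_left _ h₃
          exact h₁.trans_le h₂
        have := Nat.mul_lt_mul_of_pos_left hq hK₁
        omega
    have hshort : OverlapAt a (I % k ^ e₁ + k ^ e₁ * (I / k ^ e₂))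
        (T % k ^ e₁ + k ^ e₁ * (T / k ^ e₂)) := by
      rw [overlapAt_iff_summaryOverlap hk hG (Nat.mod_lt _ hK₁), heq,
        ← overlapAt_iff_summaryOverlap hk hG (Nat.mod_lt _ hK₂), Nat.mod_add_div, Nat.mod_add_div]
      exact h
    refine ih _ ?_ hshort rfl
    have hI := hdec I
    have hT := hdec T
    omega

lemma primrec_pow : Primrec₂ ((· ^ ·) : ℕ → ℕ → ℕ) :=
  Primrec₂.unpaired'.1 Nat.Primrec.pow

lemma primrec_summaryBound : Primrec summaryBound := by
  unfold summaryBound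
  have h : Primrec fun N : ℕ => N * (3 * (N * (3 * 2))) :=
    Primrec.nat_mul.comp .id (Primrec.nat_mul.comp (.const 3)
      (Primrec.nat_mul.comp .id (.const (3 * 2))))
  exact Primrec.nat_mul.comp (.const 2) (primrec_pow.comp (.const 2) h)

lemma dfaoRun_lowDigits (k : ℕ) (trans : List (List ℕ)) (q e n : ℕ) :
    dfaoRun trans q (lowDigits k e n) =
      ((fun s : ℕ × ℕ => ((trans.getD s.1 []).getD (s.2 % k) 0, s.2 / k))^[e] (q, n)).1 := by
  induction e generalizing q n with
  | zero => rfl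
  | succ e ih => exact ih _ _

lemma primrec_dfaoOutput :
    Primrec₂ fun (p : ℕ × List (List ℕ) × ℕ × List ℕ) (n : ℕ) =>
      dfaoOutput p.1 p.2.1 p.2.2.2 p.2.2.1 n := by
  unfold dfaoOutput
  simp only [dfaoRun_lowDigits]
  have hstep : Primrec₂ fun (p : (ℕ × List (List ℕ) × ℕ × List ℕ) × ℕ) (s : ℕ × ℕ) =>
      ((p.1.2.1.getD s.1 []).getD (s.2 % p.1.1) 0, s.2 / p.1.1) := by
    have hk : Primrec fun x : ((ℕ × List (List ℕ) × ℕ × List ℕ) × ℕ) × (ℕ × ℕ) => x.1.1.1 :=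
      Primrec.fst.comp (Primrec.fst.comp .fst)
    have ht : Primrec fun x : ((ℕ × List (List ℕ) × ℕ × List ℕ) × ℕ) × (ℕ × ℕ) => x.1.1.2.1 :=
      Primrec.fst.comp (Primrec.snd.comp (Primrec.fst.comp .fst))
    have hm : Primrec fun x : ((ℕ × List (List ℕ) × ℕ × List ℕ) × ℕ) × (ℕ × ℕ) => x.2.2 :=
      Primrec.snd.comp .snd
    exact Primrec.pair
      ((Primrec.list_getD 0).comp ((Primrec.list_getD []).comp ht (Primrec.fst.comp .snd))
        (Primrec.nat_mod.comp hm hk))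
      (Primrec.nat_div.comp hm hk)
  refine (Primrec.list_getD 0).comp
    (Primrec.snd.comp (Primrec.snd.comp (Primrec.snd.comp .fst))) (Primrec.fst.comp ?_)
  exact Primrec.nat_iterate .snd
    (Primrec.pair (Primrec.fst.comp (Primrec.snd.comp (Primrec.snd.comp .fst))) .snd) hstep

/-- A bound on the least position and period of an overlap in the sequence generated by an
encoded DFAO that contains one. -/
def overlapBound (p : ℕ × List (List ℕ) × ℕ × List ℕ) : ℕ :=
  p.1 ^ summaryBound (p.2.2.1 + Encodable.encode p.2.1 + 1)

lemma primrec_overlapBound : Primrec overlapBound :=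
  primrec_pow.comp .fst (primrec_summaryBound.comp (Primrec.succ.comp
    (Primrec.nat_add.comp (Primrec.fst.comp (Primrec.snd.comp .snd))
      (Primrec.encode.comp (Primrec.fst.comp .snd)))))

section BoundedQuantifiers

variable {α : Type*} [Primcodable α]

lemma PrimrecRel.primrecPred_forall_lt {R : ℕ → α → Prop} {B : α → ℕ} (hR : PrimrecRel R)
    (hB : Primrec B) : PrimrecPred fun x => ∀ n < B x, R n x :=
  (hR.forall_mem_list.comp (Primrec.list_range.comp hB) .id).of_eq fun _ => by simp

lemma PrimrecRel.primrecPred_exists_lt {R : ℕ → α → Prop} {B : α → ℕ} (hR : PrimrecRel R)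
    (hB : Primrec B) : PrimrecPred fun x => ∃ n < B x, R n x :=
  (hR.exists_mem_list.comp (Primrec.list_range.comp hB) .id).of_eq fun _ => by simp

lemma primrecPred_overlapAt {v : α → ℕ → ℕ} (hv : Primrec₂ v) {I T : α → ℕ} (hI : Primrec I)
    (hT : Primrec T) : PrimrecPred fun x => OverlapAt (v x) (I x) (T x) := by
  have hEq : PrimrecRel fun (J : ℕ) (x : α) => v x (I x + J) = v x (I x + T x + J) :=
    Primrec.eq.comp
      (hv.comp .snd (Primrec.nat_add.comp (hI.comp .snd) .fst))
      (hv.comp .snd (Primrec.nat_add.comp (Primrec.nat_add.comp (hI.comp .snd) (hT.comp .snd))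
        .fst))
  refine ((Primrec.nat_le.comp (.const 1) hT).and
    (hEq.primrecPred_forall_lt (Primrec.succ.comp hT))).of_eq fun x => ?_
  simp only [OverlapAt, Nat.lt_succ_iff]

lemma primrecPred_exists_overlapAt_lt {v : α → ℕ → ℕ} (hv : Primrec₂ v) {B : α → ℕ}
    (hB : Primrec B) :
    PrimrecPred fun x => ∃ I < B x, ∃ T < B x, OverlapAt (v x) I T := by
  have hAt : PrimrecRel fun (T : ℕ) (y : ℕ × α) => OverlapAt (v y.2) y.1 T :=
    primrecPred_overlapAt (v := fun x : ℕ × ℕ × α => v x.2.2)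
      (hv.comp (Primrec.snd.comp (Primrec.snd.comp .fst)) .snd) (Primrec.fst.comp .snd) .fst
  have hI : PrimrecRel fun (I : ℕ) (x : α) => ∃ T < B x, OverlapAt (v x) I T :=
    hAt.primrecPred_exists_lt (hB.comp .snd)
  exact hI.primrecPred_exists_lt hB

end BoundedQuantifiers

lemma containsOverlap_iff_exists_small {k : ℕ} {trans : List (List ℕ)} {q0 : ℕ} {out : List ℕ}
    {a : ℕ → ℕ} (hk : 2 ≤ k) (h : dfaoGenerates k trans q0 out a) :
    ContainsOverlap a ↔ ∃ I < overlapBound (k, trans, q0, out),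
      ∃ T < overlapBound (k, trans, q0, out), OverlapAt a I T := by
  constructor
  · rintro ⟨I, T, hIT⟩
    refine exists_small_overlapAt hk (st := fun e r => dfaoRun trans q0 (lowDigits k e r))
      (fun e r => ?_) (fun e r m hr => h.eq_output hk hr m) hIT
    have := dfaoRun_le trans q0 (lowDigits k e r)
    dsimp only
    omega
  · rintro ⟨I, -, T, -, hIT⟩
    exact ⟨I, T, hIT⟩

/-- It is decidable, given `k ≥ 2` and a DFAO generating a `k`-automatic
sequence `a`, whether `a` contains an overlap (equivalently, whether `a` is
overlap-free). -/
theorem overlapFree_decidable :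
    ∃ f : ℕ × List (List ℕ) × ℕ × List ℕ → Bool,
      Computable f ∧
      ∀ (k : ℕ) (trans : List (List ℕ)) (q0 : ℕ) (out : List ℕ) (a : ℕ → ℕ),
        2 ≤ k → dfaoGenerates k trans q0 out a →
        (f (k, trans, q0, out) = true ↔ ContainsOverlap a) := by
  obtain ⟨_, hf⟩ := primrecPred_exists_overlapAt_lt primrec_dfaoOutput
    primrec_overlapBound
  refine ⟨_, hf.to_comp, fun k trans q0 out a hk h => ?_⟩
  have ha : dfaoOutput k trans out q0 = a := by
    funext n
    have := h.eq_output hk (e := 0) (r := 0) (by simp) n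
    simpa [lowDigits, dfaoRun] using this.symm
  rw [decide_eq_true_eq, containsOverlap_iff_exists_small hk h, ← ha]
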